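/- Fix T > 0 and let τ be an exotic coloured tree with effective size |τ| > 1. For t ∈ (0, T), the function t ↦ Π^e_t(τ) is differentiable and (d/dt) Π^e_t(τ) = Σ_{τ' ∈ R_e⁻(τ)} Π^e_t(τ'), the sum running with multiplicity over the family R_e⁻(τ). -/

import Mathlib

/-- The two colours for non-root vertices of an exotic coloured tree. -/
inductive XColour : Type
  | alpha : XColour
  | beta : XColour
  deriving DecidableEq

/-- An exotic coloured tree: a finite non-planar rooted tree with vertex set
`Fin (n+1)`, distinguished (uncoloured) root `0`, edges oriented towards the root
(encoded by the parent map), whose non-root vertices are coloured by `{α, β}`,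
together with a fixed perfect pairing `mate` of the β-vertices (the exotic
decoration); in particular the number of β-vertices is even. -/
structure ExoticTree : Type where
  n : ℕ
  parent : Fin (n + 1) → Fin (n + 1)
  colour : Fin (n + 1) → Option XColour
  mate : Fin (n + 1) → Fin (n + 1)
  parent_root : parent 0 = 0
  reaches_root : ∀ v, parent^[n] v = 0
  colour_root : colour 0 = none
  colour_nonroot : ∀ v, v ≠ 0 → colour v ≠ none
  mate_beta : ∀ v, colour v = some XColour.beta →
      colour (mate v) = some XColour.beta ∧ mate (mate v) = v ∧ mate v ≠ v
  mate_nonbeta : ∀ v, colour v ≠ some XColour.beta → mate v = v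

namespace ExoticTree

/-- The number of children (incoming edges) `𝔫(v)` of a vertex. -/
def nChildren (t : ExoticTree) (v : Fin (t.n + 1)) : ℕ :=
  (Finset.univ.filter fun w => t.parent w = v ∧ w ≠ v).card

/-- A vertex is a leaf if it has no children. -/
def IsLeaf (t : ExoticTree) (v : Fin (t.n + 1)) : Prop := ∀ w, t.parent w = v → w = v

/-- The number of α-vertices. -/
def numAlpha (t : ExoticTree) : ℕ :=
  (Finset.univ.filter fun v : Fin (t.n + 1) => t.colour v = some XColour.alpha).card

/-- The number of β-vertices. -/
def numBeta (t : ExoticTree) : ℕ :=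
  (Finset.univ.filter fun v : Fin (t.n + 1) => t.colour v = some XColour.beta).card

/-- The number of β-pairs (each pair represented by its smaller member). -/
def numPairs (t : ExoticTree) : ℕ :=
  (Finset.univ.filter fun v : Fin (t.n + 1) =>
    t.colour v = some XColour.beta ∧ v < t.mate v).card

/-- The effective size `|τ|`: `1` (the root) plus the number of α-vertices plus the
number of β-pairs. -/
def effSize (t : ExoticTree) : ℕ := 1 + t.numAlpha + t.numPairs

/-- The edge grading `𝔩(τ) = |τ| − 1`. -/
def edgeCount (t : ExoticTree) : ℕ := t.effSize - 1

/-- Isomorphism of exotic coloured trees: a root-preserving bijection of the vertices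
commuting with the parent maps and preserving colours and the β-pairings. -/
def Iso (t₁ t₂ : ExoticTree) : Prop :=
  ∃ e : Fin (t₁.n + 1) ≃ Fin (t₂.n + 1), e 0 = 0 ∧
    (∀ v, t₂.parent (e v) = e (t₁.parent v)) ∧
    (∀ v, t₂.colour (e v) = t₁.colour v) ∧
    (∀ v, t₂.mate (e v) = e (t₁.mate v))

/-- The symmetry factor `σₑ(τ)`: the order of the group of automorphisms (root-preserving
tree automorphisms preserving colours and mapping paired β-vertices to paired
β-vertices). -/
noncomputable def sigmaE (t : ExoticTree) : ℕ :=
  Nat.card {g : Equiv.Perm (Fin (t.n + 1)) //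
    g 0 = 0 ∧ (∀ v, t.parent (g v) = g (t.parent v)) ∧
    (∀ v, t.colour (g v) = t.colour v) ∧ (∀ v, t.mate (g v) = g (t.mate v))}


/-- The Heaviside step function with the Itô prescription `Θ(x) = 1` for `x > 0`
and `Θ(x) = 0` for `x ≤ 0`. -/
noncomputable def Heaviside (x : ℝ) : ℝ := if 0 < x then 1 else 0

/-- The integration variables of the realization map: one per α-vertex and one shared
per β-pair (the pair represented by its smaller member). -/
def itemSet (t : ExoticTree) : Finset (Fin (t.n + 1)) :=
  Finset.univ.filter fun v =>
    t.colour v = some XColour.alpha ∨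
      (t.colour v = some XColour.beta ∧ v < t.mate v)

/-- The representative carrying the integration variable of a vertex: a β-vertex
shares the variable of its mate (both members of a pair carry the same variable). -/
def timeRep (t : ExoticTree) (v : Fin (t.n + 1)) : Fin (t.n + 1) :=
  if t.colour v = some XColour.beta ∧ t.mate v < v then t.mate v else v

/-- The time assigned to a vertex: the root's variable is fixed to `time`, every other
vertex carries the integration variable of its representative. -/
noncomputable def vertexTime (t : ExoticTree) (time : ℝ)
    (x : {v : Fin (t.n + 1) // v ∈ t.itemSet} → ℝ) (v : Fin (t.n + 1)) : ℝ :=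
  if h : t.timeRep v ∈ t.itemSet then x ⟨t.timeRep v, h⟩ else time

/-- The exotic realization map `Π^e_time(t)`: the integral over `[0,T]^{𝔩(t)}` (one
variable per α-vertex, one shared variable per β-pair, the root's variable fixed to
`time`) of the product over all edges `e = (parent, child)` of
`Θ(t_parent − t_child)`. -/
noncomputable def realize (t : ExoticTree) (T time : ℝ) : ℝ :=
  ∫ x in Set.univ.pi fun _ : {v : Fin (t.n + 1) // v ∈ t.itemSet} => Set.Icc (0 : ℝ) T,
    ∏ v ∈ Finset.univ.filter fun v : Fin (t.n + 1) => v ≠ 0,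
      Heaviside (t.vertexTime time x (t.parent v) - t.vertexTime time x v)


/-- The α-vertices that are children of the root (effective α-edges at the root). -/
def rootAlphaChildren (t : ExoticTree) : Finset (Fin (t.n + 1)) :=
  Finset.univ.filter fun v =>
    t.colour v = some XColour.alpha ∧ t.parent v = 0 ∧ v ≠ 0

/-- The β-pairs both of whose members are children of the root (effective β-edges at
the root; each pair represented by its smaller member). -/
def rootBetaPairs (t : ExoticTree) : Finset (Fin (t.n + 1)) :=
  Finset.univ.filter fun v =>
    t.colour v = some XColour.beta ∧ v < t.mate v ∧
    t.parent v = 0 ∧ t.parent (t.mate v) = 0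

/-- `t'` is (a copy of) the tree obtained from `t` by removing the effective edge at
the root below the α-vertex `v` (a child of the root): `v` is deleted and its
children are attached to the root. -/
def IsRootAlphaContraction (t : ExoticTree) (v : Fin (t.n + 1)) (t' : ExoticTree) : Prop :=
  t.colour v = some XColour.alpha ∧ t.parent v = 0 ∧
  ∃ e : Fin (t'.n + 1) ↪ Fin (t.n + 1), e 0 = 0 ∧ Set.range e = {u | u ≠ v} ∧
    (∀ w, t.colour (e w) = t'.colour w) ∧
    (∀ w, t.mate (e w) = e (t'.mate w)) ∧
    ∀ w, (t.parent (e w) = v → t'.parent w = 0) ∧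
      (t.parent (e w) ≠ v → e (t'.parent w) = t.parent (e w))

/-- `t'` is (a copy of) the tree obtained from `t` by removing the effective double
edge at the root below the β-pair `v`, `mate v` (both children of the root): both
β-vertices are deleted and all their children are attached to the root. -/
def IsRootBetaPairContraction (t : ExoticTree) (v : Fin (t.n + 1)) (t' : ExoticTree) : Prop :=
  t.colour v = some XColour.beta ∧ t.parent v = 0 ∧ t.parent (t.mate v) = 0 ∧
  ∃ e : Fin (t'.n + 1) ↪ Fin (t.n + 1), e 0 = 0 ∧
    Set.range e = {u | u ≠ v ∧ u ≠ t.mate v} ∧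
    (∀ w, t.colour (e w) = t'.colour w) ∧
    (∀ w, t.mate (e w) = e (t'.mate w)) ∧
    ∀ w, ((t.parent (e w) = v ∨ t.parent (e w) = t.mate v) → t'.parent w = 0) ∧
      (¬(t.parent (e w) = v ∨ t.parent (e w) = t.mate v) →
        e (t'.parent w) = t.parent (e w))

end ExoticTree

open ExoticTree

section

open MeasureTheory

/-- The points of `[0, y)^ι` such that `x j < x i` whenever `R i j`. -/
def orderRegion {ι : Type*} (R : ι → ι → Prop) (y : ℝ) : Set (ι → ℝ) :=
  {x | (∀ i, 0 ≤ x i ∧ x i < y) ∧ ∀ i j, R i j → x j < x i}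

lemma measurableSet_orderRegion {ι : Type*} [Countable ι] (R : ι → ι → Prop) (y : ℝ) :
    MeasurableSet (orderRegion R y) := by
  refine MeasurableSet.inter (s₁ := {x : ι → ℝ | ∀ i, 0 ≤ x i ∧ x i < y})
    (s₂ := {x : ι → ℝ | ∀ i j, R i j → x j < x i}) ?_ ?_
  · simp only [Set.ofPred_forall]
    exact MeasurableSet.iInter fun i =>
      (measurableSet_le measurable_const (measurable_pi_apply i)).inter
        (measurableSet_lt (measurable_pi_apply i) measurable_const)
  · simp only [Set.ofPred_forall]
    exact MeasurableSet.iInter fun i => MeasurableSet.iInter fun j => MeasurableSet.iInter fun _ =>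
      measurableSet_lt (measurable_pi_apply j) (measurable_pi_apply i)

lemma volume_orderRegion_ne_top {ι : Type*} [Fintype ι] (R : ι → ι → Prop) (y : ℝ) :
    volume (orderRegion R y) ≠ ⊤ := by
  refine ne_top_of_le_ne_top (b := volume (Set.univ.pi fun _ : ι => Set.Ico 0 y)) ?_
    (measure_mono fun x hx i _ => hx.1 i)
  rw [volume_pi_pi]
  exact ENNReal.prod_ne_top fun i _ => by simp

lemma volume_orderRegion_congr {ι κ : Type*} [Fintype ι] [Fintype κ] (e : ι ≃ κ)
    {R : ι → ι → Prop} {S : κ → κ → Prop} (h : ∀ a b, R a b ↔ S (e a) (e b)) (y : ℝ) :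
    volume (orderRegion R y) = volume (orderRegion S y) := by
  rw [← (volume_measurePreserving_piCongrLeft (fun _ : κ => ℝ) e).measure_preimage
    (measurableSet_orderRegion S y).nullMeasurableSet]
  congr 1
  ext x
  simp only [orderRegion, Set.mem_preimage, Set.mem_ofPred_eq, ← e.forall_congr_right,
    MeasurableEquiv.coe_piCongrLeft, Equiv.piCongrLeft_apply_apply, h]

open scoped Pointwise in
lemma volume_orderRegion_eq_pow_mul {ι : Type*} [Fintype ι] (R : ι → ι → Prop) {y : ℝ}
    (hy : 0 < y) :
    volume (orderRegion R y)
      = ENNReal.ofReal (y ^ Fintype.card ι) * volume (orderRegion R 1) := by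
  have h : orderRegion R y = y • orderRegion R 1 := by
    ext x
    rw [Set.mem_smul_set_iff_inv_smul_mem₀ hy.ne']
    simp only [orderRegion, Set.mem_ofPred_eq, Pi.smul_apply, smul_eq_mul,
      mul_lt_mul_iff_right₀ (inv_pos.2 hy), inv_mul_lt_iff₀ hy, mul_one,
      mul_nonneg_iff_of_pos_left (inv_pos.2 hy)]
  rw [h, Measure.addHaar_smul, Module.finrank_fintype_fun_eq_card, abs_of_pos (by positivity)]

/-- The points of `ℝ^ι` whose coordinate `i` is strictly larger than all others. -/
def strictMaxAt {ι : Type*} (i : ι) : Set (ι → ℝ) := {x | ∀ j, j ≠ i → x j < x i}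

lemma measurableSet_strictMaxAt {ι : Type*} [Countable ι] (i : ι) :
    MeasurableSet (strictMaxAt i) := by
  simp only [strictMaxAt, Set.ofPred_forall]
  exact MeasurableSet.iInter fun j => MeasurableSet.iInter fun _ =>
    measurableSet_lt (measurable_pi_apply j) (measurable_pi_apply i)

lemma volume_setOf_apply_eq_apply {ι : Type*} [Fintype ι] {i j : ι} (h : i ≠ j) :
    volume {x : ι → ℝ | x i = x j} = 0 := by
  classical
  have hker : {x : ι → ℝ | x i = x j} = LinearMap.ker
      (LinearMap.proj (R := ℝ) (φ := fun _ : ι => ℝ) i - LinearMap.proj j) := by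
    ext x
    simp [sub_eq_zero]
  rw [hker]
  refine Measure.addHaar_submodule _ _ fun htop => ?_
  have : Pi.single i (1 : ℝ) ∈ LinearMap.ker
      (LinearMap.proj (R := ℝ) (φ := fun _ : ι => ℝ) i - LinearMap.proj j) := htop ▸ trivial
  simp [h.symm] at this

lemma ae_exists_mem_strictMaxAt {ι : Type*} [Fintype ι] [Nonempty ι] :
    ∀ᵐ x : ι → ℝ, ∃ i, x ∈ strictMaxAt i := by
  have : ∀ᵐ x : ι → ℝ, ∀ i j, i ≠ j → x i ≠ x j := by
    simp only [ae_all_iff]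
    intro i j h
    simpa [ae_iff] using volume_setOf_apply_eq_apply h
  filter_upwards [this] with x hx
  obtain ⟨i, hi⟩ := Finite.exists_max x
  exact ⟨i, fun j hj => (hi j).lt_of_ne (hx j i hj)⟩

lemma volume_eq_sum_inter_strictMaxAt {ι : Type*} [Fintype ι] [Nonempty ι]
    {A : Set (ι → ℝ)} (hA : MeasurableSet A) :
    volume A = ∑ i, volume (A ∩ strictMaxAt i) := by
  have h : A =ᵐ[volume] ⋃ i, A ∩ strictMaxAt i := by
    filter_upwards [ae_exists_mem_strictMaxAt (ι := ι)] with x hx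
    refine propext ⟨fun hxA => ?_, fun hx' => ?_⟩
    · obtain ⟨i, hi⟩ := hx
      exact Set.mem_iUnion.2 ⟨i, hxA, hi⟩
    · obtain ⟨i, hi⟩ := Set.mem_iUnion.1 hx'
      exact hi.1
  rw [measure_congr h, measure_iUnion _ fun i => hA.inter (measurableSet_strictMaxAt i),
    tsum_fintype]
  intro i j hij
  refine Set.disjoint_left.2 fun x hi hj => ?_
  exact lt_asymm (hi.2 j hij.symm) (hj.2 i hij)

lemma orderRegion_inter_strictMaxAt_eq_empty {ι : Type*} {R : ι → ι → Prop} {i j : ι}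
    (h : R j i) (y : ℝ) : orderRegion R y ∩ strictMaxAt i = ∅ := by
  refine Set.eq_empty_of_forall_notMem fun x hx => ?_
  have hlt := hx.1.2 j i h
  rcases eq_or_ne j i with rfl | hne
  · exact lt_irrefl _ hlt
  · exact lt_asymm hlt (hx.2 j hne)

/-- The restriction of a relation to the complement of a point. -/
def restrictNe {ι : Type*} (R : ι → ι → Prop) (i : ι) : {j // ¬j = i} → {j // ¬j = i} → Prop :=
  fun a b => R a b

lemma volume_orderRegion_inter_strictMaxAt {ι : Type*} [Fintype ι] [DecidableEq ι]
    {R : ι → ι → Prop} {i : ι} (h : ∀ j, ¬R j i) (y : ℝ) :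
    volume (orderRegion R y ∩ strictMaxAt i)
      = ∫⁻ s in Set.Ico 0 y, volume (orderRegion (restrictNe R i) s) := by
  let B : Set (ℝ × ({j // ¬j = i} → ℝ)) :=
    {p | p.1 ∈ Set.Ico 0 y ∧ p.2 ∈ orderRegion (restrictNe R i) p.1}
  have hB : MeasurableSet B := by
    have hB' : B = {p | p.1 ∈ Set.Ico 0 y} ∩ ({p | ∀ j, 0 ≤ p.2 j ∧ p.2 j < p.1} ∩
        {p | ∀ a b, restrictNe R i a b → p.2 b < p.2 a}) := rfl
    rw [hB']
    simp only [Set.ofPred_forall, Set.ofPred_and]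
    refine MeasurableSet.inter (measurable_fst measurableSet_Ico) (MeasurableSet.inter
      (MeasurableSet.iInter fun j => MeasurableSet.inter ?_ ?_)
      (MeasurableSet.iInter fun a => MeasurableSet.iInter fun b => MeasurableSet.iInter fun _ => ?_))
    · exact measurableSet_le measurable_const (by fun_prop)
    · exact measurableSet_lt (by fun_prop) (by fun_prop)
    · exact measurableSet_lt (by fun_prop) (by fun_prop)
  have hsplit : MeasurePreserving
      (MeasurableEquiv.piEquivPiSubtypeProd (fun _ : ι => ℝ) (· = i)) volume
      (volume.prod volume) := by
    rw [← Measure.volume_eq_prod]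
    convert volume_preserving_piEquivPiSubtypeProd (fun _ : ι => ℝ) (· = i)
    rfl
  have hmp := ((volume_preserving_piUnique fun _ : {j // j = i} => ℝ).prod
    (MeasurePreserving.id (volume : Measure ({j // ¬j = i} → ℝ)))).comp hsplit
  have hpre : orderRegion R y ∩ strictMaxAt i = (Prod.map
      (MeasurableEquiv.piUnique fun _ : {j // j = i} => ℝ) id ∘
        MeasurableEquiv.piEquivPiSubtypeProd (fun _ : ι => ℝ) (· = i)) ⁻¹' B := by
    ext x
    change _ ↔ (0 ≤ x i ∧ x i < y) ∧
      (∀ j : {j // ¬j = i}, 0 ≤ x j ∧ x j < x i) ∧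
        ∀ a b : {j // ¬j = i}, R a b → x b < x a
    constructor
    · rintro ⟨⟨h1, h2⟩, h3⟩
      exact ⟨h1 i, fun j => ⟨(h1 j).1, h3 j j.2⟩, fun a b => h2 a b⟩
    · rintro ⟨h1, h2, h3⟩
      refine ⟨⟨fun j => ?_, fun a b hab => ?_⟩, fun j hj => (h2 ⟨j, hj⟩).2⟩
      · by_cases hj : j = i
        · exact hj ▸ h1
        · exact ⟨(h2 ⟨j, hj⟩).1, (h2 ⟨j, hj⟩).2.trans h1.2⟩
      · have hb : ¬b = i := fun hb => h a (hb ▸ hab)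
        by_cases ha : a = i
        · exact ha ▸ (h2 ⟨b, hb⟩).2
        · exact h3 ⟨a, ha⟩ ⟨b, hb⟩ hab
  rw [hpre, hmp.measure_preimage hB.nullMeasurableSet, Measure.prod_apply hB,
    ← lintegral_indicator measurableSet_Ico]
  refine lintegral_congr fun s => ?_
  by_cases hs : s ∈ Set.Ico 0 y
  · rw [Set.indicator_of_mem hs]
    congr 1
    ext z
    exact ⟨fun hz => hz.2, fun hz => ⟨hs, hz⟩⟩
  · rw [Set.indicator_of_notMem hs]
    refine (congrArg _ (Set.eq_empty_of_forall_notMem fun z hz => hs hz.1)).trans measure_empty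

lemma lintegral_Ico_ofReal_pow (k : ℕ) {y : ℝ} (hy : 0 ≤ y) :
    ∫⁻ s in Set.Ico 0 y, ENNReal.ofReal (s ^ k)
      = ENNReal.ofReal (y ^ (k + 1) / (k + 1)) := by
  rw [setLIntegral_congr Ico_ae_eq_Ioc, ← ofReal_integral_eq_lintegral_ofReal,
    ← intervalIntegral.integral_of_le hy, integral_pow]
  · simp
  · exact (continuous_pow k).integrableOn_Ioc
  · exact (ae_restrict_iff' measurableSet_Ioc).2 (.of_forall fun s hs => pow_nonneg hs.1.le k)

lemma volume_real_orderRegion_eq_sum {ι : Type*} [Fintype ι] [DecidableEq ι] [Nonempty ι]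
    (R : ι → ι → Prop) [DecidablePred fun i => ∀ j, ¬R j i] {y : ℝ} (hy : 0 < y) :
    volume.real (orderRegion R y) = ∑ i with ∀ j, ¬R j i,
      y ^ (Fintype.card {j // ¬j = i} + 1) / (Fintype.card {j // ¬j = i} + 1) *
        volume.real (orderRegion (restrictNe R i) 1) := by
  have key : ∀ i, (∀ j, ¬R j i) → volume (orderRegion R y ∩ strictMaxAt i) =
      ENNReal.ofReal (y ^ (Fintype.card {j // ¬j = i} + 1) / (Fintype.card {j // ¬j = i} + 1)) *
        volume (orderRegion (restrictNe R i) 1) := by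
    intro i hi
    rw [volume_orderRegion_inter_strictMaxAt hi, ← lintegral_Ico_ofReal_pow _ hy.le,
      ← lintegral_mul_const' _ _ (volume_orderRegion_ne_top _ _),
      ← setLIntegral_congr Ioo_ae_eq_Ico, ← setLIntegral_congr Ioo_ae_eq_Ico]
    exact setLIntegral_congr_fun measurableSet_Ioo fun s hs =>
      volume_orderRegion_eq_pow_mul _ hs.1
  rw [measureReal_def, volume_eq_sum_inter_strictMaxAt (measurableSet_orderRegion R y),
    ENNReal.toReal_sum fun i _ => measure_ne_top_of_subset Set.inter_subset_left
      (volume_orderRegion_ne_top R y), Finset.sum_filter]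
  refine Finset.sum_congr rfl fun i _ => ?_
  split_ifs with hi
  · rw [key i hi, ENNReal.toReal_mul, ENNReal.toReal_ofReal (by positivity), measureReal_def]
  · push Not at hi
    obtain ⟨j, hj⟩ := hi
    rw [orderRegion_inter_strictMaxAt_eq_empty hj, measure_empty, ENNReal.toReal_zero]

lemma hasDerivAt_volume_real_orderRegion {ι : Type*} [Fintype ι] [DecidableEq ι] [Nonempty ι]
    (R : ι → ι → Prop) [DecidablePred fun i => ∀ j, ¬R j i] {y : ℝ} (hy : 0 < y) :
    HasDerivAt (fun y => volume.real (orderRegion R y))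
      (∑ i with ∀ j, ¬R j i, volume.real (orderRegion (restrictNe R i) y)) y := by
  have hsum : HasDerivAt (fun y : ℝ => ∑ i with ∀ j, ¬R j i,
      y ^ (Fintype.card {j // ¬j = i} + 1) / (Fintype.card {j // ¬j = i} + 1) *
        volume.real (orderRegion (restrictNe R i) 1))
      (∑ i with ∀ j, ¬R j i, volume.real (orderRegion (restrictNe R i) y)) y := by
    refine HasDerivAt.fun_sum fun i _ => ?_
    have h := (((hasDerivAt_pow (Fintype.card {j // ¬j = i} + 1) y).div_const
      ((Fintype.card {j // ¬j = i} : ℝ) + 1)).mul_const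
        (volume.real (orderRegion (restrictNe R i) 1)))
    refine h.congr_deriv ?_
    rw [measureReal_def _ (orderRegion _ y), volume_orderRegion_eq_pow_mul _ hy, ENNReal.toReal_mul,
      ENNReal.toReal_ofReal (by positivity), measureReal_def]
    push_cast
    field_simp
  refine hsum.congr_of_eventuallyEq ?_
  filter_upwards [lt_mem_nhds hy] with z hz
  exact volume_real_orderRegion_eq_sum R hz

namespace ExoticTree

lemma mate_mate (t : ExoticTree) (v : Fin (t.n + 1)) : t.mate (t.mate v) = v := by
  by_cases h : t.colour v = some XColour.beta
  · exact (t.mate_beta v h).2.1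
  · rw [t.mate_nonbeta v h, t.mate_nonbeta v h]

lemma mate_eq_iff (t : ExoticTree) {u v : Fin (t.n + 1)} : t.mate u = v ↔ u = t.mate v :=
  ⟨fun h => h ▸ (t.mate_mate u).symm, fun h => h ▸ t.mate_mate v⟩

lemma mate_zero (t : ExoticTree) : t.mate 0 = 0 :=
  t.mate_nonbeta 0 (by simp [t.colour_root])

lemma timeRep_eq_min (t : ExoticTree) (v : Fin (t.n + 1)) : t.timeRep v = min v (t.mate v) := by
  unfold timeRep
  by_cases h : t.colour v = some XColour.beta
  · split_ifs with h'
    · exact (min_eq_right h'.2.le).symm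
    · exact (min_eq_left (not_lt.1 fun hlt => h' ⟨h, hlt⟩)).symm
  · rw [if_neg fun h' => h h'.1, t.mate_nonbeta v h, min_self]

lemma timeRep_mate (t : ExoticTree) (v : Fin (t.n + 1)) :
    t.timeRep (t.mate v) = t.timeRep v := by
  rw [timeRep_eq_min, timeRep_eq_min, mate_mate, min_comm]

lemma timeRep_zero (t : ExoticTree) : t.timeRep 0 = 0 := by
  rw [timeRep_eq_min, mate_zero, min_self]

lemma timeRep_eq_self_or_mate (t : ExoticTree) (v : Fin (t.n + 1)) :
    t.timeRep v = v ∨ t.timeRep v = t.mate v := by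
  rw [timeRep_eq_min]
  exact min_choice _ _

lemma eq_or_eq_mate_of_timeRep_eq (t : ExoticTree) {u v : Fin (t.n + 1)}
    (h : t.timeRep u = t.timeRep v) : u = v ∨ u = t.mate v := by
  rcases t.timeRep_eq_self_or_mate u with hu | hu <;>
    rcases t.timeRep_eq_self_or_mate v with hv | hv <;> rw [hu, hv] at h
  · exact .inl h
  · exact .inr h
  · exact .inr (t.mate_eq_iff.1 h)
  · exact .inl (by rw [t.mate_eq_iff.1 h, mate_mate])

lemma timeRep_eq_zero_iff (t : ExoticTree) {v : Fin (t.n + 1)} : t.timeRep v = 0 ↔ v = 0 := by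
  refine ⟨fun h => ?_, fun h => h ▸ t.timeRep_zero⟩
  rcases t.eq_or_eq_mate_of_timeRep_eq (h.trans t.timeRep_zero.symm) with h | h
  · exact h
  · rw [h, mate_zero]

lemma mem_itemSet_iff_le_mate (t : ExoticTree) {v : Fin (t.n + 1)} :
    v ∈ t.itemSet ↔ v ≠ 0 ∧ v ≤ t.mate v := by
  rw [itemSet, Finset.mem_filter_univ]
  constructor
  · rintro (h | ⟨h, hlt⟩)
    · refine ⟨?_, (t.mate_nonbeta v (by simp [h])).ge⟩
      rintro rfl
      simp [t.colour_root] at h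
    · refine ⟨?_, hlt.le⟩
      rintro rfl
      simp [t.colour_root] at h
  · rintro ⟨h0, hle⟩
    rcases hc : t.colour v with _ | _ | _
    · exact absurd hc (t.colour_nonroot v h0)
    · exact .inl rfl
    · exact .inr ⟨rfl, hle.lt_of_ne (t.mate_beta v hc).2.2.symm⟩

lemma mem_itemSet (t : ExoticTree) {v : Fin (t.n + 1)} :
    v ∈ t.itemSet ↔ v ≠ 0 ∧ t.timeRep v = v := by
  rw [mem_itemSet_iff_le_mate, timeRep_eq_min, min_eq_left_iff]

lemma timeRep_timeRep (t : ExoticTree) (v : Fin (t.n + 1)) :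
    t.timeRep (t.timeRep v) = t.timeRep v := by
  rcases t.timeRep_eq_self_or_mate v with h | h
  · rw [h, h]
  · rw [h, timeRep_mate, h]

lemma timeRep_mem_itemSet (t : ExoticTree) {v : Fin (t.n + 1)} (hv : v ≠ 0) :
    t.timeRep v ∈ t.itemSet :=
  t.mem_itemSet.2 ⟨fun h => hv (t.timeRep_eq_zero_iff.1 h), t.timeRep_timeRep v⟩

lemma timeRep_eq_iff (t : ExoticTree) {u v : Fin (t.n + 1)} (hv : v ∈ t.itemSet) :
    t.timeRep u = v ↔ u = v ∨ u = t.mate v := by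
  have hrep := (t.mem_itemSet.1 hv).2
  constructor
  · intro h
    exact t.eq_or_eq_mate_of_timeRep_eq (h.trans hrep.symm)
  · rintro (rfl | rfl)
    · exact hrep
    · rw [timeRep_mate, hrep]

/-- The relation between integration variables given by the edges not incident to the root:
`t.itemRel i j` says that some vertex carrying `j` has a parent carrying `i`. -/
def itemRel (t : ExoticTree) (i j : {v // v ∈ t.itemSet}) : Prop :=
  ∃ v, t.parent v ≠ 0 ∧ t.timeRep (t.parent v) = i ∧ t.timeRep v = j

lemma vertexTime_zero (t : ExoticTree) (y : ℝ) (x : {v // v ∈ t.itemSet} → ℝ) :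
    t.vertexTime y x 0 = y := by
  rw [vertexTime, dif_neg]
  rw [timeRep_zero, mem_itemSet]
  exact fun h => h.1 rfl

lemma vertexTime_of_ne_zero (t : ExoticTree) (y : ℝ) (x : {v // v ∈ t.itemSet} → ℝ)
    {v : Fin (t.n + 1)} (hv : v ≠ 0) :
    t.vertexTime y x v = x ⟨t.timeRep v, t.timeRep_mem_itemSet hv⟩ :=
  dif_pos _

lemma vertexTime_of_timeRep_eq (t : ExoticTree) (y : ℝ) (x : {v // v ∈ t.itemSet} → ℝ)
    {v : Fin (t.n + 1)} {i : {v // v ∈ t.itemSet}} (h : t.timeRep v = i) :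
    t.vertexTime y x v = x i := by
  have hv : v ≠ 0 := by
    rintro rfl
    exact (t.mem_itemSet.1 i.2).1 (h ▸ t.timeRep_zero)
  rw [vertexTime_of_ne_zero _ _ _ hv]
  exact congrArg x (Subtype.ext h)

lemma vertexTime_lt_of_forall_lt_parent (t : ExoticTree) {y : ℝ} {x : {v // v ∈ t.itemSet} → ℝ}
    (h : ∀ v ≠ 0, t.vertexTime y x v < t.vertexTime y x (t.parent v))
    {v : Fin (t.n + 1)} (hv : v ≠ 0) : t.vertexTime y x v < y := by
  have key : ∀ k v, t.parent^[k] v = 0 → v ≠ 0 → t.vertexTime y x v < y := by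
    intro k
    induction k with
    | zero => exact fun v hk hv => absurd hk hv
    | succ k ih =>
      intro v hk hv
      by_cases hp : t.parent v = 0
      · have := h v hv
        rwa [hp, vertexTime_zero] at this
      · exact (h v hv).trans (ih _ hk hp)
  exact key t.n v (t.reaches_root v) hv

lemma mem_orderRegion_itemRel_iff (t : ExoticTree) {T y : ℝ} (hyT : y ≤ T)
    (x : {v // v ∈ t.itemSet} → ℝ) :
    x ∈ orderRegion t.itemRel y ↔
      (∀ v ≠ 0, t.vertexTime y x v < t.vertexTime y x (t.parent v)) ∧
        x ∈ Set.univ.pi fun _ => Set.Icc (0 : ℝ) T := by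
  constructor
  · rintro ⟨h1, h2⟩
    refine ⟨fun v hv => ?_, fun i _ => ⟨(h1 i).1, (h1 i).2.le.trans hyT⟩⟩
    rw [vertexTime_of_ne_zero _ _ _ hv]
    by_cases hp : t.parent v = 0
    · rw [hp, vertexTime_zero]
      exact (h1 _).2
    · rw [vertexTime_of_ne_zero _ _ _ hp]
      exact h2 _ _ ⟨v, hp, rfl, rfl⟩
  · rintro ⟨h1, h2⟩
    refine ⟨fun i => ⟨(h2 i trivial).1, ?_⟩, ?_⟩
    · have hi := t.mem_itemSet.1 i.2
      have := t.vertexTime_lt_of_forall_lt_parent h1 hi.1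
      rwa [t.vertexTime_of_timeRep_eq y x hi.2] at this
    · rintro i j ⟨v, hp, hi, hj⟩
      have hv : v ≠ 0 := by
        rintro rfl
        exact hp t.parent_root
      rw [← t.vertexTime_of_timeRep_eq y x hi, ← t.vertexTime_of_timeRep_eq y x hj]
      exact h1 v hv

lemma realize_eq_volume_real (t : ExoticTree) {T y : ℝ} (hyT : y ≤ T) :
    t.realize T y = volume.real (orderRegion t.itemRel y) := by
  let B : Set ({v // v ∈ t.itemSet} → ℝ) :=
    {x | ∀ v ≠ 0, t.vertexTime y x v < t.vertexTime y x (t.parent v)}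
  have hvt : ∀ v, Measurable fun x => t.vertexTime y x v := by
    intro v
    unfold vertexTime
    split_ifs with h
    · exact measurable_pi_apply _
    · exact measurable_const
  have hB : MeasurableSet B := by
    simp only [B, Set.ofPred_forall]
    exact MeasurableSet.iInter fun v => MeasurableSet.iInter fun _ =>
      measurableSet_lt (hvt v) (hvt (t.parent v))
  have hprod : ∀ x, (∏ v ∈ Finset.univ.filter fun v : Fin (t.n + 1) => v ≠ 0,
      Heaviside (t.vertexTime y x (t.parent v) - t.vertexTime y x v))
        = B.indicator (fun _ => (1 : ℝ)) x := by
    intro x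
    classical
    unfold Heaviside
    rw [Finset.prod_ite_zero, Set.indicator_apply]
    simp [B]
  have hBA : B ∩ Set.univ.pi (fun _ => Set.Icc (0 : ℝ) T) = orderRegion t.itemRel y :=
    Set.ext fun x => (t.mem_orderRegion_itemRel_iff hyT x).symm
  unfold realize
  simp only [hprod]
  rw [integral_indicator_const _ hB, measureReal_restrict_apply hB, hBA, smul_eq_mul, mul_one]

/-- `t'` is obtained from `t` by deleting all vertices carrying the variable of `v`, their
children being attached to the root. -/
structure IsRootContraction (t : ExoticTree) (v : Fin (t.n + 1)) (t' : ExoticTree)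
    (e : Fin (t'.n + 1) ↪ Fin (t.n + 1)) : Prop where
  map_zero : e 0 = 0
  mem_range : ∀ u, u ∈ Set.range e ↔ t.timeRep u ≠ v
  map_mate : ∀ w, t.mate (e w) = e (t'.mate w)
  parent_eq_zero : ∀ w, t.timeRep (t.parent (e w)) = v → t'.parent w = 0
  map_parent : ∀ w, t.timeRep (t.parent (e w)) ≠ v → e (t'.parent w) = t.parent (e w)

namespace IsRootContraction

variable {t t' : ExoticTree} {v : Fin (t.n + 1)} {e : Fin (t'.n + 1) ↪ Fin (t.n + 1)}

lemma timeRep_map_timeRep (h : t.IsRootContraction v t' e) (w : Fin (t'.n + 1)) :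
    t.timeRep (e (t'.timeRep w)) = t.timeRep (e w) := by
  rcases t'.timeRep_eq_self_or_mate w with hw | hw
  · rw [hw]
  · rw [hw, ← h.map_mate, timeRep_mate]

lemma map_eq_zero_iff (h : t.IsRootContraction v t' e) {w : Fin (t'.n + 1)} :
    e w = 0 ↔ w = 0 :=
  ⟨fun hw => e.injective (hw.trans h.map_zero.symm), fun hw => hw ▸ h.map_zero⟩

lemma timeRep_eq_of_timeRep_map_eq (h : t.IsRootContraction v t' e) {w w' : Fin (t'.n + 1)}
    (hw : t.timeRep (e w) = t.timeRep (e w')) : t'.timeRep w = t'.timeRep w' := by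
  rcases t.eq_or_eq_mate_of_timeRep_eq hw with hw | hw
  · rw [e.injective hw]
  · rw [h.map_mate] at hw
    rw [e.injective hw, timeRep_mate]

/-- The integration variables of a contraction are those of the tree, except the deleted one. -/
noncomputable def itemEquiv (h : t.IsRootContraction v t' e) (hv : v ∈ t.itemSet) :
    {w // w ∈ t'.itemSet} ≃ {i : {u // u ∈ t.itemSet} // ¬i = ⟨v, hv⟩} :=
  Equiv.ofBijective
    (fun w => ⟨⟨t.timeRep (e w), t.timeRep_mem_itemSet fun hw =>
        (t'.mem_itemSet.1 w.2).1 (h.map_eq_zero_iff.1 hw)⟩,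
      fun hw => (h.mem_range _).1 ⟨_, rfl⟩ (congrArg Subtype.val hw)⟩) <| by
    constructor
    · intro w w' hw
      have := h.timeRep_eq_of_timeRep_map_eq (congrArg (fun i => i.1.1) hw)
      rw [(t'.mem_itemSet.1 w.2).2, (t'.mem_itemSet.1 w'.2).2] at this
      exact Subtype.ext this
    · rintro ⟨⟨i, hi⟩, hiv⟩
      have hi' := t.mem_itemSet.1 hi
      obtain ⟨w, rfl⟩ := (h.mem_range i).2 fun hiv' => hiv (Subtype.ext (hi'.2.symm.trans hiv'))
      refine ⟨⟨t'.timeRep w, t'.timeRep_mem_itemSet fun hw =>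
        hi'.1 (h.map_eq_zero_iff.2 hw)⟩, Subtype.ext (Subtype.ext ?_)⟩
      exact (h.timeRep_map_timeRep w).trans hi'.2

lemma coe_itemEquiv (h : t.IsRootContraction v t' e) (hv : v ∈ t.itemSet)
    (w : {w // w ∈ t'.itemSet}) : ((h.itemEquiv hv w).1 : Fin (t.n + 1)) = t.timeRep (e w) :=
  rfl

lemma timeRep_map_eq_itemEquiv_iff (h : t.IsRootContraction v t' e) (hv : v ∈ t.itemSet)
    {w : Fin (t'.n + 1)} {a : {w // w ∈ t'.itemSet}} :
    t.timeRep (e w) = (h.itemEquiv hv a).1 ↔ t'.timeRep w = a := by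
  rw [coe_itemEquiv]
  constructor
  · intro hw
    rw [h.timeRep_eq_of_timeRep_map_eq hw, (t'.mem_itemSet.1 a.2).2]
  · intro hw
    rw [← hw, h.timeRep_map_timeRep]

lemma itemRel_iff (h : t.IsRootContraction v t' e) (hv : v ∈ t.itemSet)
    (a b : {w // w ∈ t'.itemSet}) :
    t'.itemRel a b ↔ restrictNe t.itemRel ⟨v, hv⟩ (h.itemEquiv hv a) (h.itemEquiv hv b) := by
  constructor
  · rintro ⟨w, hp, ha, hb⟩
    have hpv : t.timeRep (t.parent (e w)) ≠ v := fun hpv => hp (h.parent_eq_zero w hpv)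
    refine ⟨e w, ?_, ?_, (h.timeRep_map_eq_itemEquiv_iff hv).2 hb⟩
    · rw [← h.map_parent w hpv]
      exact fun h0 => hp (h.map_eq_zero_iff.1 h0)
    · rw [← h.map_parent w hpv]
      exact (h.timeRep_map_eq_itemEquiv_iff hv).2 ha
  · rintro ⟨u, hp, ha, hb⟩
    have hne : ∀ c, ((h.itemEquiv hv c).1 : Fin (t.n + 1)) ≠ v := fun c hc =>
      (h.itemEquiv hv c).2 (Subtype.ext hc)
    obtain ⟨w, rfl⟩ := (h.mem_range u).2 (hb ▸ hne b)
    have hpar := h.map_parent w (ha ▸ hne a)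
    rw [← hpar] at hp ha
    exact ⟨w, fun h0 => hp (h.map_eq_zero_iff.2 h0),
      (h.timeRep_map_eq_itemEquiv_iff hv).1 ha, (h.timeRep_map_eq_itemEquiv_iff hv).1 hb⟩

lemma realize_eq (h : t.IsRootContraction v t' e) (hv : v ∈ t.itemSet) {T y : ℝ} (hyT : y ≤ T) :
    t'.realize T y = volume.real (orderRegion (restrictNe t.itemRel ⟨v, hv⟩) y) := by
  rw [t'.realize_eq_volume_real hyT, measureReal_def, measureReal_def,
    volume_orderRegion_congr (h.itemEquiv hv) (h.itemRel_iff hv)]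

end IsRootContraction

lemma mem_itemSet_of_mem_rootAlphaChildren (t : ExoticTree) {v : Fin (t.n + 1)}
    (h : v ∈ t.rootAlphaChildren) : v ∈ t.itemSet := by
  simp only [rootAlphaChildren, Finset.mem_filter_univ] at h
  simp [itemSet, h.1]

lemma mem_itemSet_of_mem_rootBetaPairs (t : ExoticTree) {v : Fin (t.n + 1)}
    (h : v ∈ t.rootBetaPairs) : v ∈ t.itemSet := by
  simp only [rootBetaPairs, Finset.mem_filter_univ] at h
  simp [itemSet, h.1, h.2.1]

lemma disjoint_rootAlphaChildren_rootBetaPairs (t : ExoticTree) :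
    Disjoint t.rootAlphaChildren t.rootBetaPairs := by
  refine Finset.disjoint_left.2 fun v ha hb => ?_
  simp only [rootAlphaChildren, rootBetaPairs, Finset.mem_filter_univ] at ha hb
  simp [ha.1] at hb

lemma mem_rootAlphaChildren_union_rootBetaPairs (t : ExoticTree) (i : {v // v ∈ t.itemSet}) :
    i.1 ∈ t.rootAlphaChildren ∪ t.rootBetaPairs ↔ ∀ j, ¬t.itemRel j i := by
  have hi := t.mem_itemSet.1 i.2
  have hrel : (∀ j, ¬t.itemRel j i) ↔ t.parent i = 0 ∧ t.parent (t.mate i) = 0 := by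
    constructor
    · intro h
      have h' : ∀ u, t.timeRep u = i → t.parent u = 0 := fun u hu => by
        by_contra hp
        exact h ⟨_, t.timeRep_mem_itemSet hp⟩ ⟨u, hp, rfl, hu⟩
      exact ⟨h' _ hi.2, h' _ (by rw [timeRep_mate, hi.2])⟩
    · rintro ⟨h1, h2⟩ j ⟨u, hp, -, hu⟩
      rcases (t.timeRep_eq_iff i.2).1 hu with rfl | rfl
      · exact hp h1
      · exact hp h2
  have hle := (t.mem_itemSet_iff_le_mate.1 i.2).2
  rw [hrel, Finset.mem_union, rootAlphaChildren, rootBetaPairs, Finset.mem_filter_univ,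
    Finset.mem_filter_univ]
  rcases hc : t.colour i with _ | _ | _
  · exact absurd hc (t.colour_nonroot _ hi.1)
  · have := t.mate_nonbeta i (by simp [hc])
    simp [this, hi.1]
  · have := hle.lt_of_ne (t.mate_beta _ hc).2.2.symm
    simp [this]

lemma IsRootAlphaContraction.exists_isRootContraction {t t' : ExoticTree} {v : Fin (t.n + 1)}
    (h : t.IsRootAlphaContraction v t') (hv : v ∈ t.itemSet) :
    ∃ e, t.IsRootContraction v t' e := by
  obtain ⟨hc, -, e, h0, hr, -, hm, hp⟩ := h
  have hrep : ∀ u, t.timeRep u = v ↔ u = v := fun u => by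
    rw [t.timeRep_eq_iff hv, t.mate_nonbeta v (by simp [hc]), or_self]
  exact ⟨e, h0, fun u => by simp [hr, hrep], hm, fun w hw => (hp w).1 ((hrep _).1 hw),
    fun w hw => (hp w).2 fun h => hw ((hrep _).2 h)⟩

lemma IsRootBetaPairContraction.exists_isRootContraction {t t' : ExoticTree} {v : Fin (t.n + 1)}
    (h : t.IsRootBetaPairContraction v t') (hv : v ∈ t.itemSet) :
    ∃ e, t.IsRootContraction v t' e := by
  obtain ⟨-, -, -, e, h0, hr, -, hm, hp⟩ := h
  have hrep : ∀ u, t.timeRep u = v ↔ u = v ∨ u = t.mate v := fun u => t.timeRep_eq_iff hv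
  exact ⟨e, h0, fun u => by simp [hr, hrep], hm, fun w hw => (hp w).1 ((hrep _).1 hw),
    fun w hw => (hp w).2 fun h => hw ((hrep _).2 h)⟩

lemma nonempty_itemSet (t : ExoticTree) (ht : 1 < t.effSize) : Nonempty {v // v ∈ t.itemSet} := by
  have h : 0 < t.numAlpha ∨ 0 < t.numPairs := by
    unfold effSize at ht
    omega
  rcases h with h | h <;> obtain ⟨v, hv⟩ := Finset.card_pos.1 h <;>
    rw [Finset.mem_filter_univ] at hv <;> exact ⟨v, by simp [itemSet, hv]⟩

end ExoticTree

end

/-- Fix `T > 0` and let `τ` be an exotic coloured tree with effective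
size `|τ| > 1`.  For `t ∈ (0, T)` the function `t ↦ Π^e_t(τ)` is differentiable with
`(d/dt) Π^e_t(τ) = Σ_{τ' ∈ R_e⁻(τ)} Π^e_t(τ')`, the sum running with multiplicity
(one member per choice of effective edge at the root) over the family `R_e⁻(τ)` of
trees obtained from `τ` by removing one effective edge at the root. -/
theorem stmt7 (T : ℝ) (hT : 0 < T) (t : ExoticTree) (ht : 1 < t.effSize)
    (cα : (v : Fin (t.n + 1)) → v ∈ t.rootAlphaChildren → ExoticTree)
    (cβ : (v : Fin (t.n + 1)) → v ∈ t.rootBetaPairs → ExoticTree)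
    (hcα : ∀ v h, t.IsRootAlphaContraction v (cα v h))
    (hcβ : ∀ v h, t.IsRootBetaPairContraction v (cβ v h))
    (x : ℝ) (hx : x ∈ Set.Ioo (0 : ℝ) T) :
    HasDerivAt (fun y => t.realize T y)
      ((∑ v ∈ t.rootAlphaChildren.attach, (cα v.1 v.2).realize T x) +
        ∑ v ∈ t.rootBetaPairs.attach, (cβ v.1 v.2).realize T x) x := by
  classical
  have := t.nonempty_itemSet ht
  have hder : HasDerivAt (fun y => t.realize T y)
      (∑ i with ∀ j, ¬t.itemRel j i,
        MeasureTheory.volume.real (orderRegion (restrictNe t.itemRel i) x)) x := by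
    refine (hasDerivAt_volume_real_orderRegion t.itemRel hx.1).congr_of_eventuallyEq ?_
    filter_upwards [gt_mem_nhds hx.2] with y hy
    exact t.realize_eq_volume_real hy.le
  let g : Fin (t.n + 1) → ℝ := fun v => if hv : v ∈ t.itemSet then
    MeasureTheory.volume.real (orderRegion (restrictNe t.itemRel ⟨v, hv⟩) x) else 0
  have hg : ∀ v (hv : v ∈ t.itemSet), g v =
      MeasureTheory.volume.real (orderRegion (restrictNe t.itemRel ⟨v, hv⟩) x) :=
    fun v hv => by simp only [g, dif_pos hv]
  have hα : ∀ v h, (cα v h).realize T x = g v := fun v h => by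
    have hv := t.mem_itemSet_of_mem_rootAlphaChildren h
    obtain ⟨e, he⟩ := (hcα v h).exists_isRootContraction hv
    rw [he.realize_eq hv hx.2.le, hg v hv]
  have hβ : ∀ v h, (cβ v h).realize T x = g v := fun v h => by
    have hv := t.mem_itemSet_of_mem_rootBetaPairs h
    obtain ⟨e, he⟩ := (hcβ v h).exists_isRootContraction hv
    rw [he.realize_eq hv hx.2.le, hg v hv]
  refine hder.congr_deriv ?_
  simp only [hα, hβ]
  rw [Finset.sum_attach _ g, Finset.sum_attach _ g,
    ← Finset.sum_union t.disjoint_rootAlphaChildren_rootBetaPairs]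
  refine Finset.sum_bij (fun i _ => i.1) (fun i hi => ?_) (fun i _ j _ h => Subtype.ext h)
    (fun v hv => ?_) (fun i _ => (hg i.1 i.2).symm)
  · exact (t.mem_rootAlphaChildren_union_rootBetaPairs i).2 (Finset.mem_filter_univ i |>.1 hi)
  · have hv' : v ∈ t.itemSet := (Finset.mem_union.1 hv).elim
      t.mem_itemSet_of_mem_rootAlphaChildren t.mem_itemSet_of_mem_rootBetaPairs
    exact ⟨⟨v, hv'⟩, (Finset.mem_filter_univ _).2
      ((t.mem_rootAlphaChildren_union_rootBetaPairs ⟨v, hv'⟩).1 hv), rfl⟩
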